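/- arXiv:1703.02723 — 2 statements merged into one kernel-verified Lean document; each statement's English description precedes it below -/
import Mathlib

section
/- Let A_1, …, A_l be any partition of the ground set Fin d, let A* be a fixed set of size at most k, let G_j = Greedy(A_j, k), and let T_j = {x ∈ A* : x ∉ Greedy(A_j ∪ {x}, k)}. If f is monotone with f(∅) = 0 and has submodularity ratio at least γ_j > 0 with respect to (G_j, k), then f(G_j) ≥ (1 − e^{−γ_j})·f(T_j). -/
open Finset

open scoped Classical in
/-- One step of the deterministic greedy algorithm: add to `A` the element of `S \ A`
maximizing the marginal gain `f (insert j A) - f A`, ties broken by the fixed linear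
order on `Fin d`. -/
noncomputable def greedyStep {d : ℕ} (f : Finset (Fin d) → ℝ) (S A : Finset (Fin d)) :
    Finset (Fin d) :=
  if h : (S \ A).Nonempty then
    insert
      (((S \ A).filter fun j => ∀ j' ∈ S \ A, f (insert j' A) ≤ f (insert j A)).min'
        (by
          obtain ⟨j, hj, hmax⟩ := (S \ A).exists_max_image (fun j => f (insert j A)) h
          exact ⟨j, Finset.mem_filter.mpr ⟨hj, hmax⟩⟩)) A
  else A

/-- `greedy f S k` is the set produced by `k` steps of greedy selection from candidates `S`,
starting from `∅`. -/
noncomputable def greedy {d : ℕ} (f : Finset (Fin d) → ℝ) (S : Finset (Fin d)) :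
    ℕ → Finset (Fin d)
  | 0 => ∅
  | k + 1 => greedyStep f S (greedy f S k)

/-- `f` has submodularity ratio at least `γ` with respect to `(U, k)`. -/
def SubmodRatioGE {d : ℕ} (f : Finset (Fin d) → ℝ) (U : Finset (Fin d)) (k : ℕ) (γ : ℝ) : Prop :=
  ∀ L S : Finset (Fin d), L ⊆ U → Disjoint L S → S.card ≤ k →
    γ * (f (L ∪ S) - f L) ≤ ∑ j ∈ S, (f (insert j L) - f L)

theorem greedyStep_spec {d : ℕ} (f : Finset (Fin d) → ℝ) {S A : Finset (Fin d)}
    (h : (S \ A).Nonempty) :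
    ∃ m ∈ S \ A, (∀ j ∈ S \ A, f (insert j A) ≤ f (insert m A)) ∧
      (∀ m' ∈ S \ A, (∀ j ∈ S \ A, f (insert j A) ≤ f (insert m' A)) → m ≤ m') ∧
      greedyStep f S A = insert m A := by
  classical
  rw [greedyStep, dif_pos h]
  generalize_proofs hne
  have hm := Finset.mem_filter.mp (Finset.min'_mem _ hne)
  exact ⟨_, hm.1, hm.2,
    fun m' hm' hmax => Finset.min'_le _ _ (Finset.mem_filter.mpr ⟨hm', hmax⟩), rfl⟩

theorem subset_greedyStep {d : ℕ} (f : Finset (Fin d) → ℝ) (S A : Finset (Fin d)) :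
    A ⊆ greedyStep f S A := by
  by_cases h : (S \ A).Nonempty
  · obtain ⟨m, -, -, -, heq⟩ := greedyStep_spec f h
    rw [heq]
    exact Finset.subset_insert _ _
  · rw [greedyStep, dif_neg h]

theorem greedy_mono {d : ℕ} (f : Finset (Fin d) → ℝ) (S : Finset (Fin d)) :
    Monotone (greedy f S) :=
  monotone_nat_of_le_succ fun n => subset_greedyStep f S (greedy f S n)

/-- A candidate that is not selected does not influence a greedy step, and its marginal gain is
at most that of the selected element. -/
theorem greedyStep_of_notMem_insert {d : ℕ} (f : Finset (Fin d) → ℝ) {S A : Finset (Fin d)}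
    {x : Fin d} (hx : x ∉ greedyStep f (insert x S) A) :
    greedyStep f (insert x S) A = greedyStep f S A ∧
      f (insert x A) ≤ f (greedyStep f S A) := by
  have hxA : x ∉ A := fun h => hx (subset_greedyStep f _ _ h)
  have hxmem : x ∈ insert x S \ A := by simp [hxA]
  obtain ⟨m, hm, hmax, hmin, heq⟩ := greedyStep_spec f ⟨x, hxmem⟩
  have hmx : m ≠ x := by
    rintro rfl
    exact hx (heq ▸ Finset.mem_insert_self _ _)
  have hmS : m ∈ S \ A := by
    simp only [Finset.mem_sdiff, Finset.mem_insert, hmx, false_or] at hm ⊢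
    exact hm
  have hsub : S \ A ⊆ insert x S \ A :=
    Finset.sdiff_subset_sdiff (Finset.subset_insert _ _) subset_rfl
  obtain ⟨n, hn, hnmax, hnmin, hneq⟩ := greedyStep_spec f ⟨m, hmS⟩
  have hnm : n = m := le_antisymm
    (hnmin m hmS fun j hj => hmax j (hsub hj))
    (hmin n (hsub hn) fun j hj => (hmax j hj).trans (hnmax m hmS))
  subst hnm
  exact ⟨heq.trans hneq.symm, hneq ▸ hmax x hxmem⟩

theorem greedy_insert_eq_of_notMem {d : ℕ} (f : Finset (Fin d) → ℝ) {S : Finset (Fin d)}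
    {x : Fin d} {k : ℕ} (hx : x ∉ greedy f (insert x S) k) :
    greedy f (insert x S) k = greedy f S k := by
  induction k with
  | zero => rfl
  | succ k ih =>
    have hprev := ih fun h => hx (greedy_mono f _ k.le_succ h)
    simp only [greedy, hprev] at hx ⊢
    exact (greedyStep_of_notMem_insert f hx).1

theorem notMem_greedy_and_gain_le {d : ℕ} (f : Finset (Fin d) → ℝ) {S : Finset (Fin d)}
    {x : Fin d} {k i : ℕ} (hx : x ∉ greedy f (insert x S) k) (hi : i < k) :
    x ∉ greedy f S i ∧ f (insert x (greedy f S i)) ≤ f (greedy f S (i + 1)) := by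
  have hsucc : x ∉ greedy f (insert x S) (i + 1) := fun h => hx (greedy_mono f _ hi h)
  have hprev : x ∉ greedy f (insert x S) i := fun h => hsucc (greedy_mono f _ i.le_succ h)
  have heq := greedy_insert_eq_of_notMem f hprev
  refine ⟨heq ▸ hprev, ?_⟩
  simp only [greedy, heq] at hsucc ⊢
  exact (greedyStep_of_notMem_insert f hsucc).2

/-- A sequence whose gap to a target `t` shrinks by a fraction `γ / k` in each of `k` steps
reaches at least `(1 - e^{-γ}) t`. -/
theorem one_sub_exp_neg_mul_le_of_gap {a : ℕ → ℝ} {t γ : ℝ} {k : ℕ} (hk : 0 < k)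
    (ha : Monotone a) (ha0 : a 0 = 0) (ht : 0 ≤ t)
    (hstep : ∀ i < k, γ * (t - a i) ≤ k * (a (i + 1) - a i)) :
    (1 - Real.exp (-γ)) * t ≤ a k := by
  rcases le_or_gt t (a k) with h | h
  · nlinarith [mul_nonneg (Real.exp_pos (-γ)).le ht]
  have hk' : (0 : ℝ) < k := by exact_mod_cast hk
  have key : ∀ i ≤ k, t - a i ≤ Real.exp (-(γ / k)) ^ i * t := by
    intro i
    induction i with
    | zero => simp [ha0]
    | succ i ih =>
      intro hi
      have hpos : 0 ≤ t - a i := by linarith [ha (Nat.le_of_succ_le hi)]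
      have hgain : γ / k * (t - a i) ≤ a (i + 1) - a i := by
        rw [div_mul_eq_mul_div, div_le_iff₀ hk']
        linarith [hstep i hi]
      calc t - a (i + 1) ≤ (-(γ / k) + 1) * (t - a i) := by linarith
        _ ≤ Real.exp (-(γ / k)) * (t - a i) := by
          gcongr
          exact Real.add_one_le_exp _
        _ ≤ Real.exp (-(γ / k)) * (Real.exp (-(γ / k)) ^ i * t) := by
          gcongr
          exact ih (Nat.le_of_succ_le hi)
        _ = Real.exp (-(γ / k)) ^ (i + 1) * t := by ring
  have hfin := key k le_rfl
  rw [← Real.exp_nat_mul, mul_neg, mul_div_cancel₀ _ hk'.ne'] at hfin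
  linarith

open scoped Classical in
/-- **Local greedy bound.** Let `A_1, …, A_l` partition the ground set `Fin d`, let `A*` be a
fixed set of size at most `k`, `G_j = Greedy(A_j, k)`, and
`T_j = {x ∈ A* : x ∉ Greedy(A_j ∪ {x}, k)}`. If `f` is monotone with `f ∅ = 0` and has
submodularity ratio at least `γ_j > 0` with respect to `(G_j, k)`, then
`f (G_j) ≥ (1 - e^{-γ_j}) · f (T_j)`. -/
theorem local_greedy_bound (d l k : ℕ) (f : Finset (Fin d) → ℝ)
    (hmono : ∀ A B : Finset (Fin d), A ⊆ B → f A ≤ f B) (hzero : f ∅ = 0)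
    (P : Fin l → Finset (Fin d))
    (hdisj : ∀ i j : Fin l, i ≠ j → Disjoint (P i) (P j))
    (hcover : Finset.univ.biUnion P = (Finset.univ : Finset (Fin d)))
    (Astar : Finset (Fin d)) (hAcard : Astar.card ≤ k)
    (γ : Fin l → ℝ) :
    ∀ j : Fin l, 0 < γ j → SubmodRatioGE f (greedy f (P j) k) k (γ j) →
      (1 - Real.exp (-(γ j))) *
          f (Astar.filter fun x => x ∉ greedy f (insert x (P j)) k) ≤
        f (greedy f (P j) k) := by
  intro j hγ hratio
  set T := Astar.filter fun x => x ∉ greedy f (insert x (P j)) k with hT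
  have hTcard : T.card ≤ k := (Finset.card_filter_le _ _).trans hAcard
  rcases k.eq_zero_or_pos with rfl | hk
  · rw [Finset.card_eq_zero.mp (Nat.le_zero.mp hTcard)]
    simp [greedy, hzero]
  have hf : Monotone f := fun A B h => hmono A B h
  refine one_sub_exp_neg_mul_le_of_gap (a := fun i => f (greedy f (P j) i)) hk
    (hf.comp (greedy_mono f _)) hzero (hzero ▸ hf (Finset.empty_subset T)) fun i hi => ?_
  have hTi : ∀ x ∈ T, x ∉ greedy f (P j) i ∧
      f (insert x (greedy f (P j) i)) ≤ f (greedy f (P j) (i + 1)) := fun x hx =>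
    notMem_greedy_and_gain_le f (Finset.mem_filter.mp hx).2 hi
  have hstep : f (greedy f (P j) i) ≤ f (greedy f (P j) (i + 1)) :=
    hf (greedy_mono f _ i.le_succ)
  calc γ j * (f T - f (greedy f (P j) i))
      ≤ γ j * (f (greedy f (P j) i ∪ T) - f (greedy f (P j) i)) := by
        gcongr
        exact hf Finset.subset_union_right
    _ ≤ ∑ x ∈ T, (f (insert x (greedy f (P j) i)) - f (greedy f (P j) i)) :=
        hratio _ _ (greedy_mono f _ hi.le)
          (Finset.disjoint_right.mpr fun x hx => (hTi x hx).1) hTcard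
    _ ≤ ∑ _x ∈ T, (f (greedy f (P j) (i + 1)) - f (greedy f (P j) i)) :=
        Finset.sum_le_sum fun x hx => sub_le_sub_right (hTi x hx).2 _
    _ = T.card * (f (greedy f (P j) (i + 1)) - f (greedy f (P j) i)) := by
        rw [Finset.sum_const, nsmul_eq_mul]
    _ ≤ k * (f (greedy f (P j) (i + 1)) - f (greedy f (P j) i)) := by
        have := sub_nonneg.mpr hstep
        gcongr
end

section
/- Approximation guarantee for StochasticGreedy: Let A* maximize f over subsets of [d] of size at most k, and let A_k be the (random) output of StochasticGreedy with sparsity k and parameter δ ∈ (0,1). If f is monotone with f(∅) = 0 and has submodularity ratio at least γ > 0 with respect to (B, k) for every possible realization B of the sets A_0, …, A_k built by the algorithm, then E[f(A_k)] ≥ (1 − e^{−γ} − δ)·f(A*). -/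
open Finset

/-- Expected value of `f` on the output of `i` further steps of `StochasticGreedy` started
from the current set `A`: at each step a uniformly random subset `C` of size `s` of the
remaining elements is drawn and the element of `C` with the largest marginal gain is added. -/
noncomputable def sgExpect {d : ℕ} (f : Finset (Fin d) → ℝ) (s : ℕ) :
    ℕ → Finset (Fin d) → ℝ
  | 0, A => f A
  | i + 1, A =>
    (∑ C ∈ ((Finset.univ : Finset (Fin d)) \ A).powersetCard s,
        sgExpect f s i (greedyStep f (A ∪ C) A)) /
      (((((Finset.univ : Finset (Fin d)) \ A).powersetCard s)).card : ℝ)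

/-- `sgReachable f s i B` : the set `B` is a possible realization of the set `A_i` built by
`StochasticGreedy` (with subsample size `s`) after `i` steps. -/
inductive sgReachable {d : ℕ} (f : Finset (Fin d) → ℝ) (s : ℕ) : ℕ → Finset (Fin d) → Prop
  | init : sgReachable f s 0 ∅
  | step {i : ℕ} {A C : Finset (Fin d)} : sgReachable f s i A →
      C ∈ ((Finset.univ : Finset (Fin d)) \ A).powersetCard s →
      sgReachable f s (i + 1) (greedyStep f (A ∪ C) A)

theorem exp_mul_le_one_sub_add_mul_exp {a : ℝ} (ha0 : 0 ≤ a) (ha1 : a ≤ 1) (y : ℝ) :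
    Real.exp (a * y) ≤ 1 - a + a * Real.exp y := by
  have h := convexOn_exp.2 (Set.mem_univ (0 : ℝ)) (Set.mem_univ y) (sub_nonneg.2 ha1) ha0
    (by ring)
  simpa using h

theorem choose_le_choose_succ_mul_exp {m n : ℕ} (s : ℕ) (hmn : m + 1 ≤ n) :
    (m.choose s : ℝ) ≤ ((m + 1).choose s : ℝ) * Real.exp (-((s : ℝ) / n)) := by
  have hm : (0 : ℝ) < (m : ℝ) + 1 := by positivity
  rcases lt_or_ge m s with h | h
  · rw [Nat.choose_eq_zero_of_lt h, Nat.cast_zero]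
    positivity
  · have key : (m.choose s : ℝ) * (m + 1) = ((m + 1).choose s : ℝ) * (m + 1 - s) := by
      have := Nat.choose_mul_succ_eq m s
      have h' : ((m + 1 - s : ℕ) : ℝ) = (m : ℝ) + 1 - s := by
        rw [Nat.cast_sub (by omega)]
        push_cast
        ring
      rw [← h']
      exact_mod_cast this
    have hle : (m.choose s : ℝ) = ((m + 1).choose s : ℝ) * (1 - s / (m + 1)) := by
      field_simp
      linarith
    rw [hle]
    gcongr
    have h1 : (s : ℝ) / n ≤ s / (m + 1) := by
      have : (m : ℝ) + 1 ≤ n := by exact_mod_cast hmn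
      gcongr
    have h2 := Real.add_one_le_exp (-((s : ℝ) / n))
    linarith

theorem choose_sub_le_choose_mul_exp {n : ℕ} (s t : ℕ) (htn : t ≤ n) :
    ((n - t).choose s : ℝ) ≤ (n.choose s : ℝ) * Real.exp (-((s : ℝ) / n) * t) := by
  induction t with
  | zero => simp
  | succ t ih =>
    have h1 := choose_le_choose_succ_mul_exp (m := n - (t + 1)) (n := n) s (by omega)
    rw [show n - (t + 1) + 1 = n - t by omega] at h1
    calc ((n - (t + 1)).choose s : ℝ)
        ≤ ((n - t).choose s : ℝ) * Real.exp (-((s : ℝ) / n)) := h1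
      _ ≤ (n.choose s : ℝ) * Real.exp (-((s : ℝ) / n) * t) * Real.exp (-((s : ℝ) / n)) := by
          gcongr
          exact ih (by omega)
      _ = _ := by
          rw [mul_assoc, ← Real.exp_add]
          push_cast
          ring_nf

/-- By symmetry, every point of `T` has the same total weight `1 / #(C ∩ T)` over the
`s`-subsets `C` of `R` containing it. -/
theorem sum_powersetCard_inv_card_inter_eq {α : Type*} [DecidableEq α] {R T : Finset α}
    (hTR : T ⊆ R) (s : ℕ) {a b : α} (ha : a ∈ T) (hb : b ∈ T) :
    (∑ C ∈ R.powersetCard s, if a ∈ C then ((#(C ∩ T) : ℝ))⁻¹ else 0) =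
      ∑ C ∈ R.powersetCard s, if b ∈ C then ((#(C ∩ T) : ℝ))⁻¹ else 0 := by
  have hmap : ∀ U : Finset α, a ∈ U → b ∈ U →
      U.map (Equiv.swap a b).toEmbedding = U := by
    intro U haU hbU
    ext x
    simp only [Finset.mem_map_equiv, Equiv.symm_swap]
    rcases eq_or_ne x a with rfl | hxa
    · simp [haU, hbU]
    rcases eq_or_ne x b with rfl | hxb
    · simp [haU, hbU]
    rw [Equiv.swap_apply_of_ne_of_ne hxa hxb]
  refine Finset.sum_equiv (Equiv.finsetCongr (Equiv.swap a b)) (fun C => ?_) (fun C _ => ?_)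
  · simp only [Finset.mem_powersetCard, Equiv.finsetCongr_apply, Finset.card_map]
    conv_rhs => rw [← hmap R (hTR ha) (hTR hb)]
    rw [Finset.map_subset_map]
  · have hcard : #(C.map (Equiv.swap a b).toEmbedding ∩ T) = #(C ∩ T) := by
      conv_lhs => rw [← hmap T ha hb]
      rw [← Finset.map_inter, Finset.card_map]
    have hmem : b ∈ C.map (Equiv.swap a b).toEmbedding ↔ a ∈ C := by
      simp [Finset.mem_map_equiv]
    simp only [Equiv.finsetCongr_apply, hcard, hmem]

/-- A uniformly random `s`-subset of `R` that meets `T` contains, upon averaging over its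
intersection with `T`, a uniformly random element of `T`. -/
theorem card_mul_sum_powersetCard_average_inter {α : Type*} [DecidableEq α] {R T : Finset α}
    (hTR : T ⊆ R) (s : ℕ) (g : α → ℝ) :
    (#T : ℝ) * ∑ C ∈ R.powersetCard s, (∑ j ∈ C ∩ T, g j) * (#(C ∩ T) : ℝ)⁻¹ =
      (#{C ∈ R.powersetCard s | (C ∩ T).Nonempty} : ℝ) * ∑ j ∈ T, g j := by
  have hsum : ∀ h : α → ℝ,
      ∑ C ∈ R.powersetCard s, (∑ j ∈ C ∩ T, h j) * (#(C ∩ T) : ℝ)⁻¹ =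
      ∑ j ∈ T, h j * ∑ C ∈ R.powersetCard s, if j ∈ C then ((#(C ∩ T) : ℝ))⁻¹ else 0 := by
    intro h
    simp only [Finset.mul_sum]
    rw [Finset.sum_comm]
    refine Finset.sum_congr rfl fun C _ => ?_
    rw [Finset.inter_comm C T, ← Finset.filter_mem_eq_inter, Finset.sum_filter, Finset.sum_mul]
    refine Finset.sum_congr rfl fun j _ => ?_
    split_ifs <;> simp
  rcases T.eq_empty_or_nonempty with rfl | ⟨a, ha⟩
  · simp
  set w := ∑ C ∈ R.powersetCard s, if a ∈ C then ((#(C ∩ T) : ℝ))⁻¹ else 0 with hw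
  have hconst : ∀ h : α → ℝ,
      ∑ C ∈ R.powersetCard s, (∑ j ∈ C ∩ T, h j) * (#(C ∩ T) : ℝ)⁻¹ =
      (∑ j ∈ T, h j) * w := by
    intro h
    rw [hsum, Finset.sum_mul]
    refine Finset.sum_congr rfl fun j hj => ?_
    rw [sum_powersetCard_inv_card_inter_eq hTR s hj ha]
  have hcount : (#{C ∈ R.powersetCard s | (C ∩ T).Nonempty} : ℝ) = #T * w := by
    have h1 := hconst fun _ => 1
    simp only [Finset.sum_const, nsmul_eq_mul, mul_one] at h1
    rw [← h1, Finset.card_filter, Nat.cast_sum]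
    refine Finset.sum_congr rfl fun C _ => ?_
    by_cases hC : (C ∩ T).Nonempty
    · have : (#(C ∩ T) : ℝ) ≠ 0 := by
        exact_mod_cast hC.card_pos.ne'
      simp [hC, this]
    · simp [Finset.not_nonempty_iff_eq_empty.1 hC]
  rw [hconst, hcount]
  ring

theorem card_filter_inter_nonempty_powersetCard {α : Type*} [DecidableEq α] {R T : Finset α}
    (hTR : T ⊆ R) (s : ℕ) :
    (#{C ∈ R.powersetCard s | (C ∩ T).Nonempty} : ℝ) =
      ((#R).choose s : ℝ) - ((#R - #T).choose s : ℝ) := by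
  have h := Finset.card_filter_add_card_filter_not (s := R.powersetCard s)
    (fun C => (C ∩ T).Nonempty)
  have h2 : {C ∈ R.powersetCard s | ¬ (C ∩ T).Nonempty} = (R \ T).powersetCard s := by
    ext C
    simp only [Finset.mem_filter, Finset.mem_powersetCard, Finset.not_nonempty_iff_eq_empty,
      ← Finset.disjoint_iff_inter_eq_empty, Finset.subset_sdiff]
    tauto
  rw [h2, Finset.card_powersetCard, Finset.card_powersetCard, Finset.card_sdiff_of_subset hTR]
    at h
  rw [← h]
  push_cast
  ring

theorem card_greedyStep_le {d : ℕ} (f : Finset (Fin d) → ℝ) (S A : Finset (Fin d)) :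
    #(greedyStep f S A) ≤ #A + 1 := by
  unfold greedyStep
  split_ifs
  · exact Finset.card_insert_le _ _
  · omega

theorem insert_le_greedyStep {d : ℕ} (f : Finset (Fin d) → ℝ) {S A : Finset (Fin d)}
    {j : Fin d} (hj : j ∈ S \ A) : f (insert j A) ≤ f (greedyStep f S A) := by
  classical
  unfold greedyStep
  rw [dif_pos ⟨j, hj⟩]
  have h := Finset.min'_mem ((S \ A).filter fun j => ∀ j' ∈ S \ A, f (insert j' A) ≤ f (insert j A))
    (by
      obtain ⟨i, hi, hmax⟩ := (S \ A).exists_max_image (fun j => f (insert j A)) ⟨j, hj⟩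
      exact ⟨i, Finset.mem_filter.mpr ⟨hi, hmax⟩⟩)
  have h' := (Finset.mem_filter.1 h).2 j hj
  convert h'

theorem sgReachable.card_le {d : ℕ} {f : Finset (Fin d) → ℝ} {s i : ℕ} {A : Finset (Fin d)}
    (h : sgReachable f s i A) : #A ≤ i := by
  induction h with
  | init => simp
  | step _ _ ih => exact (card_greedyStep_le _ _ _).trans (by omega)

/-- A uniformly random `s`-subset of `R` meets `T` with probability at least
`(1 - δ) * #T / k`. -/
theorem card_filter_inter_nonempty_ge {d k s : ℕ} (hk : 0 < k) {δ : ℝ} (hδ0 : 0 < δ)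
    (hs : (d : ℝ) * Real.log (1 / δ) / k ≤ s) {R T : Finset (Fin d)} (hTR : T ⊆ R)
    (hT : #T ≤ k) :
    (1 - δ) * (#T / k) * (#R).choose s ≤
      (#{C ∈ R.powersetCard s | (C ∩ T).Nonempty} : ℝ) := by
  rcases T.eq_empty_or_nonempty with rfl | hTne
  · simp
  have hTRc := Finset.card_le_card hTR
  have hkpos : (0 : ℝ) < k := by exact_mod_cast hk
  have hn : (0 : ℝ) < #R := by exact_mod_cast hTne.card_pos.trans_le hTRc
  have hRd : (#R : ℝ) ≤ d := by exact_mod_cast (Finset.card_le_univ R).trans_eq (by simp)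
  rw [card_filter_inter_nonempty_powersetCard hTR]
  have h1 := choose_sub_le_choose_mul_exp (n := #R) s #T hTRc
  have hrate : Real.log (1 / δ) / k ≤ s / #R := by
    rw [le_div_iff₀ hn]
    rcases le_or_gt 0 (Real.log (1 / δ)) with hl | hl
    · calc Real.log (1 / δ) / k * #R ≤ Real.log (1 / δ) / k * d := by gcongr
        _ ≤ s := by linarith [hs, show Real.log (1 / δ) / k * d = d * Real.log (1 / δ) / k by ring]
    · have : Real.log (1 / δ) / k * #R ≤ 0 :=
        mul_nonpos_of_nonpos_of_nonneg (div_nonpos_of_nonpos_of_nonneg hl.le hkpos.le) hn.le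
      exact this.trans (Nat.cast_nonneg s)
  have h2 : Real.exp (-((s : ℝ) / #R) * #T) ≤ 1 - (#T / k : ℝ) + (#T / k : ℝ) * δ := by
    calc Real.exp (-((s : ℝ) / #R) * #T) ≤ Real.exp ((#T / k : ℝ) * Real.log δ) := by
          apply Real.exp_le_exp.2
          have hlog : Real.log (1 / δ) = -Real.log δ := by simp
          rw [hlog] at hrate
          have := mul_le_mul_of_nonneg_right hrate (Nat.cast_nonneg (α := ℝ) #T)
          calc -((s : ℝ) / #R) * #T ≤ -(-Real.log δ / k * #T) := by linarith
            _ = _ := by ring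
      _ ≤ 1 - (#T / k : ℝ) + (#T / k : ℝ) * Real.exp (Real.log δ) :=
          exp_mul_le_one_sub_add_mul_exp (by positivity)
            (div_le_one_of_le₀ (by exact_mod_cast hT) hkpos.le) _
      _ = _ := by rw [Real.exp_log hδ0]
  have h3 := mul_le_mul_of_nonneg_left h2 (Nat.cast_nonneg (α := ℝ) ((#R).choose s))
  linarith

/-- The expected gain of one step of `StochasticGreedy`. -/
theorem sum_greedyStep_ge {d k s : ℕ} (hk : 0 < k) {f : Finset (Fin d) → ℝ}
    (hmono : ∀ A B : Finset (Fin d), A ⊆ B → f A ≤ f B) {δ : ℝ} (hδ0 : 0 < δ) (hδ1 : δ < 1)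
    (hs : (d : ℝ) * Real.log (1 / δ) / k ≤ s) {γ : ℝ} {A : Finset (Fin d)}
    (hsub : SubmodRatioGE f A k γ) (hγ : 0 ≤ γ) {Astar : Finset (Fin d)} (hAcard : #Astar ≤ k) :
    (f A + (1 - δ) * γ / k * (f Astar - f A)) * #((univ \ A).powersetCard s) ≤
      ∑ C ∈ (univ \ A).powersetCard s, f (greedyStep f (A ∪ C) A) := by
  set R : Finset (Fin d) := univ \ A with hR
  set T := Astar \ A with hT
  have hTR : T ⊆ R := Finset.sdiff_subset_sdiff (Finset.subset_univ _) subset_rfl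
  have hTk : #T ≤ k := (Finset.card_le_card Finset.sdiff_subset).trans hAcard
  have hkpos : (0 : ℝ) < k := by exact_mod_cast hk
  have hgain0 : ∀ j, 0 ≤ f (insert j A) - f A := fun j =>
    sub_nonneg.2 (hmono _ _ (Finset.subset_insert _ _))
  have hratio : γ * (f Astar - f A) ≤ ∑ j ∈ T, (f (insert j A) - f A) := by
    refine le_trans ?_ (hsub A T subset_rfl Finset.disjoint_sdiff hTk)
    have : f Astar ≤ f (A ∪ T) := hmono _ _ (by
      rw [hT, Finset.union_sdiff_self_eq_union]
      exact Finset.subset_union_right)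
    gcongr
  have hstep : ∀ C ∈ R.powersetCard s,
      (∑ j ∈ C ∩ T, (f (insert j A) - f A)) * (#(C ∩ T) : ℝ)⁻¹ ≤
        f (greedyStep f (A ∪ C) A) - f A := by
    intro C hC
    rcases (C ∩ T).eq_empty_or_nonempty with h | h
    · rw [h]
      simpa using hmono _ _ (subset_greedyStep f (A ∪ C) A)
    · have hpos : (0 : ℝ) < #(C ∩ T) := by exact_mod_cast h.card_pos
      rw [← div_eq_mul_inv, div_le_iff₀ hpos, mul_comm, ← nsmul_eq_mul]
      refine Finset.sum_le_card_nsmul _ _ _ fun j hj => sub_le_sub_right ?_ _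
      obtain ⟨hjC, hjT⟩ := Finset.mem_inter.1 hj
      exact insert_le_greedyStep f (Finset.mem_sdiff.2
        ⟨Finset.mem_union_right _ hjC, (Finset.mem_sdiff.1 hjT).2⟩)
  have hsumstep := Finset.sum_le_sum hstep
  rw [Finset.sum_sub_distrib, Finset.sum_const, nsmul_eq_mul] at hsumstep
  have havg : (1 - δ) / k * #(R.powersetCard s) * ∑ j ∈ T, (f (insert j A) - f A) ≤
      ∑ C ∈ R.powersetCard s, (∑ j ∈ C ∩ T, (f (insert j A) - f A)) * (#(C ∩ T) : ℝ)⁻¹ := by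
    rcases T.eq_empty_or_nonempty with h | h
    · simp [h]
    · have hpos : (0 : ℝ) < #T := by exact_mod_cast h.card_pos
      refine le_of_mul_le_mul_left ?_ hpos
      rw [card_mul_sum_powersetCard_average_inter hTR, Finset.card_powersetCard]
      have := mul_le_mul_of_nonneg_right (card_filter_inter_nonempty_ge hk hδ0 hs hTR hTk)
        (Finset.sum_nonneg fun j (_ : j ∈ T) => hgain0 j)
      refine le_trans (le_of_eq ?_) this
      ring
  have hscale := mul_le_mul_of_nonneg_left hratio
    (show 0 ≤ (1 - δ) / k * (#(R.powersetCard s) : ℝ) by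
      have := sub_pos.2 hδ1
      positivity)
  have hring : (f A + (1 - δ) * γ / k * (f Astar - f A)) * #(R.powersetCard s) =
      #(R.powersetCard s) * f A +
        (1 - δ) / k * #(R.powersetCard s) * (γ * (f Astar - f A)) := by ring
  linarith

/-- If every step closes, in expectation, a fraction `x` of the gap to `v`, then `m` steps
leave at most a fraction `(1 - x) ^ m` of it. -/
theorem sub_pow_mul_le_sgExpect {d k s : ℕ} {f : Finset (Fin d) → ℝ} (hsd : s + k ≤ d + 1)
    {x v : ℝ} (hx : x ≤ 1)
    (hstep : ∀ i < k, ∀ A : Finset (Fin d), sgReachable f s i A →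
      (f A + x * (v - f A)) * #((univ \ A).powersetCard s) ≤
        ∑ C ∈ (univ \ A).powersetCard s, f (greedyStep f (A ∪ C) A))
    (m : ℕ) {i : ℕ} (him : i + m ≤ k) {A : Finset (Fin d)} (hA : sgReachable f s i A) :
    v - (1 - x) ^ m * (v - f A) ≤ sgExpect f s m A := by
  induction m generalizing i A with
  | zero => simp [sgExpect]
  | succ m ih =>
    have hN : (0 : ℝ) < #((univ \ A).powersetCard s) := by
      have hAi := hA.card_le
      have : s ≤ #(univ \ A) := by
        rw [Finset.card_sdiff_of_subset (Finset.subset_univ _), Finset.card_univ, Fintype.card_fin]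
        omega
      exact_mod_cast (Finset.powersetCard_nonempty.2 this).card_pos
    rw [sgExpect, le_div_iff₀ hN]
    have hsum : ∑ C ∈ (univ \ A).powersetCard s,
        (v - (1 - x) ^ m * (v - f (greedyStep f (A ∪ C) A))) ≤
        ∑ C ∈ (univ \ A).powersetCard s, sgExpect f s m (greedyStep f (A ∪ C) A) :=
      Finset.sum_le_sum fun C hC => ih (i := i + 1) (by omega) (hA.step hC)
    refine le_trans ?_ hsum
    simp only [mul_sub, Finset.sum_sub_distrib, Finset.sum_const, nsmul_eq_mul, ← Finset.mul_sum]
    have h := mul_le_mul_of_nonneg_left (hstep i (by omega) A hA)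
      (pow_nonneg (sub_nonneg.2 hx) m)
    rw [pow_succ]
    linarith

theorem sgExpect_ge_of_submodRatio_le_one {d k : ℕ} (hk : 0 < k) {f : Finset (Fin d) → ℝ}
    (hmono : ∀ A B : Finset (Fin d), A ⊆ B → f A ≤ f B) (hzero : f ∅ = 0)
    {δ : ℝ} (hδ0 : 0 < δ) (hδ1 : δ < 1) {s : ℕ}
    (hs : (d : ℝ) * Real.log (1 / δ) / k ≤ s) (hsd : s + k ≤ d + 1)
    {γ : ℝ} (hγ0 : 0 ≤ γ) (hγ1 : γ ≤ 1)
    (hsub : ∀ i < k, ∀ B : Finset (Fin d), sgReachable f s i B → SubmodRatioGE f B k γ)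
    {Astar : Finset (Fin d)} (hAcard : #Astar ≤ k) :
    (1 - Real.exp (-γ) - δ) * f Astar ≤ sgExpect f s k ∅ := by
  have hstar : 0 ≤ f Astar := hzero ▸ hmono _ _ (Finset.empty_subset _)
  have hkpos : (1 : ℝ) ≤ k := by exact_mod_cast hk
  have hx : (1 - δ) * γ / k ≤ 1 := div_le_one_of_le₀ (by nlinarith) (by linarith)
  have h := sub_pow_mul_le_sgExpect (v := f Astar) hsd hx
    (fun i hi A hA => sum_greedyStep_ge hk hmono hδ0 hδ1 hs (hsub i hi A hA) hγ0 hAcard)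
    k (i := 0) (by omega) sgReachable.init
  rw [hzero, sub_zero] at h
  have hpow : (1 - (1 - δ) * γ / k) ^ k ≤ Real.exp (-γ) + δ := by
    calc (1 - (1 - δ) * γ / k) ^ k ≤ Real.exp (-((1 - δ) * γ / k)) ^ k := by
          refine pow_le_pow_left₀ (by linarith) ?_ k
          linarith [Real.add_one_le_exp (-((1 - δ) * γ / k))]
      _ = Real.exp ((1 - δ) * -γ) := by
          rw [← Real.exp_nat_mul]
          congr 1
          field_simp
      _ ≤ 1 - (1 - δ) + (1 - δ) * Real.exp (-γ) :=
          exp_mul_le_one_sub_add_mul_exp (by linarith) (by linarith) _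
      _ ≤ Real.exp (-γ) + δ := by nlinarith [Real.exp_pos (-γ)]
  nlinarith [mul_le_mul_of_nonneg_right hpow hstar]

/-- The submodularity-ratio inequality only weakens as `γ` decreases. -/
theorem SubmodRatioGE.mono {d k : ℕ} {f : Finset (Fin d) → ℝ}
    (hmono : ∀ A B : Finset (Fin d), A ⊆ B → f A ≤ f B) {U : Finset (Fin d)} {γ γ' : ℝ}
    (h : SubmodRatioGE f U k γ) (hγ : γ' ≤ γ) : SubmodRatioGE f U k γ' := fun L S hL hd hS =>
  (mul_le_mul_of_nonneg_right hγ (sub_nonneg.2 (hmono _ _ Finset.subset_union_left))).trans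
    (h L S hL hd hS)

/-- A submodularity ratio above one forces `f` to vanish on all sets of size at most `k`. -/
theorem SubmodRatioGE.eq_zero_of_one_lt {d k : ℕ} (hk : 0 < k) {f : Finset (Fin d) → ℝ}
    (hmono : ∀ A B : Finset (Fin d), A ⊆ B → f A ≤ f B) (hzero : f ∅ = 0)
    {U : Finset (Fin d)} {γ : ℝ} (h : SubmodRatioGE f U k γ) (hγ : 1 < γ)
    {S : Finset (Fin d)} (hS : #S ≤ k) : f S = 0 := by
  have hnonneg : ∀ T, 0 ≤ f T := fun T => hzero ▸ hmono _ _ (Finset.empty_subset T)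
  have hsingle : ∀ j, f {j} = 0 := by
    intro j
    have := h ∅ {j} (Finset.empty_subset _) (Finset.disjoint_empty_left _)
      (by rwa [Finset.card_singleton])
    simp only [Finset.empty_union, Finset.sum_singleton, insert_empty_eq, hzero, sub_zero] at this
    nlinarith [hnonneg {j}]
  have := h ∅ S (Finset.empty_subset _) (Finset.disjoint_empty_left _) hS
  simp only [Finset.empty_union, insert_empty_eq, hzero, sub_zero, hsingle,
    Finset.sum_const_zero] at this
  nlinarith [hnonneg S]

/-- **Approximation guarantee for StochasticGreedy.** `A*` maximizes the monotone function
`f` (with `f ∅ = 0`) over subsets of `[d]` of size at most `k`; `A_k` is the random output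
of `StochasticGreedy` with sparsity `k` and parameter `δ ∈ (0,1)`, which at each step
samples a uniformly random subset of size `s = ⌈d·log(1/δ)/k⌉` of the remaining elements.
If `f` has submodularity ratio at least `γ > 0` with respect to `(B, k)` for every
possible realization `B` of the sets built by the algorithm, then
`E[f (A_k)] ≥ (1 - e^{-γ} - δ) · f (A*)`. -/
theorem stochastic_greedy_guarantee (d k : ℕ) (hk : 0 < k)
    (f : Finset (Fin d) → ℝ)
    (hmono : ∀ A B : Finset (Fin d), A ⊆ B → f A ≤ f B) (hzero : f ∅ = 0)
    (δ : ℝ) (hδ0 : 0 < δ) (hδ1 : δ < 1)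
    (s : ℕ) (hs : s = ⌈(d : ℝ) * Real.log (1 / δ) / (k : ℝ)⌉₊)
    (hsd : s + k ≤ d + 1)
    (γ : ℝ) (hγ : 0 < γ)
    (hsub : ∀ i ≤ k, ∀ B : Finset (Fin d), sgReachable f s i B → SubmodRatioGE f B k γ)
    (Astar : Finset (Fin d)) (hAcard : Astar.card ≤ k)
    (hAmax : ∀ T : Finset (Fin d), T.card ≤ k → f T ≤ f Astar) :
    (1 - Real.exp (-γ) - δ) * f Astar ≤ sgExpect f s k ∅ := by
  have hs' : (d : ℝ) * Real.log (1 / δ) / k ≤ s := hs ▸ Nat.le_ceil _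
  rcases le_or_gt γ 1 with hγ1 | hγ1
  · exact sgExpect_ge_of_submodRatio_le_one hk hmono hzero hδ0 hδ1 hs' hsd hγ.le hγ1
      (fun i hi => hsub i hi.le) hAcard
  · have h := sgExpect_ge_of_submodRatio_le_one hk hmono hzero hδ0 hδ1 hs' hsd zero_le_one le_rfl
      (fun i hi B hB => (hsub i hi.le B hB).mono hmono hγ1.le) hAcard
    have hstar := (hsub 0 (Nat.zero_le k) ∅ .init).eq_zero_of_one_lt hk hmono hzero hγ1 hAcard
    rwa [hstar, mul_zero] at h ⊢
end
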